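/- Let k be an odd positive integer, s ∈ (0, π), x = cot(s), and let u : ℝ → ℝ be u(y) = cos(k·(π/2 − arctan y)). Then the principal value (1/π)·PV∫ u'(y)/(x−y) dy exists and equals (2k/π)·sin(ks)·( cos(s) + sin²(s)·ln(cot(s/2)) ) + (8k/π)·∑_{n=0}^{(k−1)/2} sin((k−1−2n)s)/((2n−1)(2n+1)(2n+3)). -/

import Mathlib

open Filter MeasureTheory

/-- The principal value `PV∫ f(y)/(x−y) dy` exists and equals `c`. -/
def HasPV (x : ℝ) (f : ℝ → ℂ) (c : ℂ) : Prop :=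
  (∀ ε : ℝ, 0 < ε → IntegrableOn (fun y : ℝ => f y / ((x : ℂ) - y)) {y : ℝ | ε ≤ |x - y|}) ∧
    Tendsto (fun ε : ℝ => ∫ y in {y : ℝ | ε ≤ |x - y|}, f y / ((x : ℂ) - y))
      (nhdsWithin 0 (Set.Ioi 0)) (nhds c)

theorem HasPV.add {x : ℝ} {f g : ℝ → ℂ} {c d : ℂ} (hf : HasPV x f c) (hg : HasPV x g d) :
    HasPV x (fun y => f y + g y) (c + d) := by
  refine ⟨fun ε hε => ?_, (hf.2.add hg.2).congr' ?_⟩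
  · simp only [add_div]
    exact (hf.1 ε hε).add (hg.1 ε hε)
  · filter_upwards [self_mem_nhdsWithin] with ε hε
    simp only [add_div]
    exact (integral_add (hf.1 ε hε) (hg.1 ε hε)).symm

theorem HasPV.const_mul {x : ℝ} {f : ℝ → ℂ} {c : ℂ} (hf : HasPV x f c) (a : ℂ) :
    HasPV x (fun y => a * f y) (a * c) := by
  refine ⟨fun ε hε => ?_, (hf.2.const_mul a).congr fun ε => ?_⟩
  · simp only [mul_div_assoc]
    exact (hf.1 ε hε).const_mul a
  · simp only [mul_div_assoc]
    exact (integral_const_mul a _).symm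

theorem measurableSet_le_abs_sub (x ε : ℝ) : MeasurableSet {y : ℝ | ε ≤ |x - y|} :=
  measurableSet_le measurable_const (by fun_prop)

theorem HasPV.of_integrable {x : ℝ} {g : ℝ → ℂ} (hg : Integrable g) :
    HasPV x (fun y => ((x : ℂ) - y) * g y) (∫ y, g y) := by
  have key : ∀ ε : ℝ, 0 < ε → ∀ y ∈ {y : ℝ | ε ≤ |x - y|},
      g y = ((x : ℂ) - y) * g y / ((x : ℂ) - y) := by
    intro ε hε y hy
    have h : x - y ≠ 0 := abs_pos.mp (hε.trans_le hy)
    have h' : (x : ℂ) - y ≠ 0 := by exact_mod_cast h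
    field_simp
  refine ⟨fun ε hε =>
    hg.integrableOn.congr_fun (key ε hε) (measurableSet_le_abs_sub x ε), ?_⟩
  have hlim : Tendsto (fun ε : ℝ => ∫ y, Set.indicator {y : ℝ | ε ≤ |x - y|} g y)
      (nhdsWithin 0 (Set.Ioi 0)) (nhds (∫ y, g y)) := by
    refine tendsto_integral_filter_of_dominated_convergence (fun y => ‖g y‖)
      (Eventually.of_forall fun ε =>
        hg.aestronglyMeasurable.indicator (measurableSet_le_abs_sub x ε))
      (Eventually.of_forall fun ε => Eventually.of_forall fun y => norm_indicator_le_norm_self _ _)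
      hg.norm ?_
    filter_upwards [Measure.ae_ne volume x] with y hy
    refine tendsto_const_nhds.congr' ?_
    have hpos : 0 < |x - y| := abs_pos.mpr (sub_ne_zero.mpr hy.symm)
    filter_upwards [nhdsWithin_le_nhds (Iio_mem_nhds hpos)] with ε hε
    have hmem : y ∈ {y : ℝ | ε ≤ |x - y|} := le_of_lt (Set.mem_Iio.mp hε)
    exact (Set.indicator_of_mem hmem g).symm
  refine hlim.congr' ?_
  filter_upwards [self_mem_nhdsWithin] with ε hε
  rw [integral_indicator (measurableSet_le_abs_sub x ε)]
  exact setIntegral_congr_fun (measurableSet_le_abs_sub x ε) (key ε hε)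

/-- The unimodular function `e^{iη}`, where `cot η = y`. -/
noncomputable def expArccot (y : ℝ) : ℂ :=
  Complex.exp (((Real.pi / 2 - Real.arctan y : ℝ) : ℂ) * Complex.I)

theorem expArccot_eq (y : ℝ) : expArccot y = (y + Complex.I) / (√(1 + y ^ 2) : ℝ) := by
  rw [expArccot, Complex.exp_mul_I, ← Complex.ofReal_cos, ← Complex.ofReal_sin,
    Real.cos_pi_div_two_sub, Real.sin_pi_div_two_sub, Real.sin_arctan, Real.cos_arctan]
  push_cast
  ring

theorem ofReal_sub_I_ne_zero (y : ℝ) : (y : ℂ) - Complex.I ≠ 0 := fun h => by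
  simpa using congrArg Complex.im h

theorem ofReal_add_I_ne_zero (y : ℝ) : (y : ℂ) + Complex.I ≠ 0 := fun h => by
  simpa using congrArg Complex.im h

theorem ofReal_one_add_sq (y : ℝ) :
    (1 : ℂ) + (y : ℂ) ^ 2 = (y + Complex.I) * (y - Complex.I) := by
  linear_combination Complex.I_sq

theorem ofReal_sqrt_one_add_sq (y : ℝ) :
    ((√(1 + y ^ 2) : ℝ) : ℂ) ^ 2 = (y + Complex.I) * (y - Complex.I) := by
  rw [← ofReal_one_add_sq]
  exact_mod_cast Real.sq_sqrt (by positivity : (0 : ℝ) ≤ 1 + y ^ 2)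

theorem expArccot_sq (y : ℝ) : expArccot y ^ 2 = (y + Complex.I) / (y - Complex.I) := by
  have h1 := ofReal_sub_I_ne_zero y
  have h2 := ofReal_add_I_ne_zero y
  rw [expArccot_eq, div_pow, ofReal_sqrt_one_add_sq]
  field_simp

theorem norm_expArccot (y : ℝ) : ‖expArccot y‖ = 1 := Complex.norm_exp_ofReal_mul_I _

theorem expArccot_pow (k : ℕ) (y : ℝ) : expArccot y ^ k =
    Complex.exp (((k * (Real.pi / 2 - Real.arctan y) : ℝ) : ℂ) * Complex.I) := by
  rw [expArccot, ← Complex.exp_nat_mul]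
  push_cast
  ring_nf

theorem hasDerivAt_expArccot (y : ℝ) :
    HasDerivAt expArccot (-Complex.I * expArccot y / (1 + (y : ℂ) ^ 2)) y := by
  refine HasDerivAt.congr_deriv (((Real.hasDerivAt_arctan y).const_sub
    (Real.pi / 2)).ofReal_comp.mul_const Complex.I).cexp ?_
  rw [expArccot]
  push_cast
  ring

theorem continuous_expArccot : Continuous expArccot :=
  continuous_iff_continuousAt.mpr fun y => (hasDerivAt_expArccot y).continuousAt

theorem tendsto_expArccot_atTop : Tendsto expArccot atTop (nhds 1) := by
  have h : Tendsto (fun y : ℝ => Complex.exp (((Real.pi / 2 - Real.arctan y : ℝ) : ℂ) * Complex.I))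
      atTop (nhds (Complex.exp (((Real.pi / 2 - Real.pi / 2 : ℝ) : ℂ) * Complex.I))) :=
    (by fun_prop : Continuous fun t : ℝ =>
      Complex.exp (((Real.pi / 2 - t : ℝ) : ℂ) * Complex.I)).continuousAt.tendsto.comp
      (tendsto_nhds_of_tendsto_nhdsWithin Real.tendsto_arctan_atTop)
  rw [sub_self, Complex.ofReal_zero, zero_mul, Complex.exp_zero] at h
  exact h

theorem tendsto_expArccot_atBot : Tendsto expArccot atBot (nhds (-1)) := by
  have h : Tendsto (fun y : ℝ => Complex.exp (((Real.pi / 2 - Real.arctan y : ℝ) : ℂ) * Complex.I))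
      atBot (nhds (Complex.exp (((Real.pi / 2 - -(Real.pi / 2) : ℝ) : ℂ) * Complex.I))) :=
    (by fun_prop : Continuous fun t : ℝ =>
      Complex.exp (((Real.pi / 2 - t : ℝ) : ℂ) * Complex.I)).continuousAt.tendsto.comp
      (tendsto_nhds_of_tendsto_nhdsWithin Real.tendsto_arctan_atBot)
  rw [sub_neg_eq_add, add_halves, Complex.exp_pi_mul_I] at h
  exact h

theorem integrable_expArccot_pow_div (p : ℕ) :
    Integrable fun y : ℝ => expArccot y ^ p / (1 + (y : ℂ) ^ 2) := by
  refine integrable_inv_one_add_sq.mono' ?_ (Eventually.of_forall fun y => ?_)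
  · refine ((continuous_expArccot.pow p).measurable.div (by fun_prop)).aestronglyMeasurable
  · have : ‖(1 : ℂ) + (y : ℂ) ^ 2‖ = 1 + y ^ 2 := by
      rw [show (1 : ℂ) + (y : ℂ) ^ 2 = ((1 + y ^ 2 : ℝ) : ℂ) by push_cast; ring,
        Complex.norm_of_nonneg (by positivity)]
    rw [norm_div, norm_pow, norm_expArccot, one_pow, this, one_div]

theorem integral_expArccot_pow_div {p : ℕ} (hp : Odd p) :
    ∫ y : ℝ, expArccot y ^ p / (1 + (y : ℂ) ^ 2) = 2 * Complex.I / p := by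
  have hp0 : (p : ℂ) ≠ 0 := by exact_mod_cast hp.pos.ne'
  have hderiv : ∀ y : ℝ, HasDerivAt (fun y : ℝ => Complex.I / p * expArccot y ^ p)
      (expArccot y ^ p / (1 + (y : ℂ) ^ 2)) y := by
    intro y
    refine (((hasDerivAt_expArccot y).pow p).const_mul (Complex.I / p)).congr_deriv ?_
    have h : expArccot y ^ p = expArccot y ^ (p - 1) * expArccot y := by
      rw [← pow_succ, Nat.sub_add_cancel hp.pos]
    rw [h]
    field_simp
    linear_combination -(expArccot y ^ (p - 1) * expArccot y / (1 + (y : ℂ) ^ 2)) * Complex.I_sq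
  rw [integral_of_hasDerivAt_of_tendsto hderiv (integrable_expArccot_pow_div p)
    ((tendsto_expArccot_atBot.pow p).const_mul _) ((tendsto_expArccot_atTop.pow p).const_mul _),
    hp.neg_one_pow]
  ring

theorem expArccot_sq_sub_sq (x y : ℝ) : expArccot y ^ 2 - expArccot x ^ 2 =
    ((x : ℂ) - y) * ((expArccot y ^ 2 - 1) / (x - Complex.I)) := by
  have h1 := ofReal_sub_I_ne_zero y
  have h2 := ofReal_sub_I_ne_zero x
  rw [expArccot_sq, expArccot_sq]
  field_simp
  ring

theorem HasPV.expArccot_step {x : ℝ} {k : ℕ} (hk : Odd k) {c : ℂ}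
    (h : HasPV x (fun y => expArccot y ^ k / (1 + (y : ℂ) ^ 2)) c) :
    HasPV x (fun y => expArccot y ^ (k + 2) / (1 + (y : ℂ) ^ 2))
      (expArccot x ^ 2 * c + 2 * Complex.I / (x - Complex.I) * (1 / (k + 2 : ℕ) - 1 / k)) := by
  have hk2 : Odd (k + 2) := hk.add_even even_two
  have hint := ((integrable_expArccot_pow_div (k + 2)).sub
    (integrable_expArccot_pow_div k)).const_mul (1 / ((x : ℂ) - Complex.I))
  have hsum := (h.const_mul (expArccot x ^ 2)).add (HasPV.of_integrable (x := x) hint)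
  simp only [Pi.sub_apply] at hsum
  rw [integral_const_mul, integral_sub (integrable_expArccot_pow_div (k + 2))
    (integrable_expArccot_pow_div k), integral_expArccot_pow_div hk2,
    integral_expArccot_pow_div hk] at hsum
  convert hsum using 1
  · funext y
    rw [pow_add]
    linear_combination (expArccot y ^ k / (1 + (y : ℂ) ^ 2)) * expArccot_sq_sub_sq x y
  · ring

theorem abs_lt_sqrt_one_add_sq (x : ℝ) : |x| < √(1 + x ^ 2) :=
  Real.lt_sqrt_of_sq_lt (by rw [sq_abs]; linarith)

theorem one_add_mul_add_sqrt_pos (x y : ℝ) :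
    0 < 1 + x * y + √(1 + x ^ 2) * √(1 + y ^ 2) := by
  have h : |x * y| ≤ √(1 + x ^ 2) * √(1 + y ^ 2) := by
    rw [abs_mul]
    exact mul_le_mul (abs_lt_sqrt_one_add_sq x).le (abs_lt_sqrt_one_add_sq y).le
      (abs_nonneg _) (Real.sqrt_nonneg _)
  linarith [neg_abs_le (x * y)]

theorem hasDerivAt_log_sub_log {x y : ℝ} (hxy : x < y) :
    HasDerivAt (fun y => (Real.log (1 + x * y + √(1 + x ^ 2) * √(1 + y ^ 2))
      - Real.log (y - x)) / √(1 + x ^ 2)) (1 / (√(1 + y ^ 2) * (x - y))) y := by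
  have hw : 0 < √(1 + y ^ 2) := by positivity
  have hv : 0 < √(1 + x ^ 2) := by positivity
  have hw2 : √(1 + y ^ 2) ^ 2 = 1 + y ^ 2 := Real.sq_sqrt (by positivity)
  have hv2 : √(1 + x ^ 2) ^ 2 = 1 + x ^ 2 := Real.sq_sqrt (by positivity)
  have hpos := one_add_mul_add_sqrt_pos x y
  have hsub : y - x ≠ 0 := (sub_pos.mpr hxy).ne'
  have hsub' : x - y ≠ 0 := (sub_neg.mpr hxy).ne
  have hsqrt : HasDerivAt (fun y : ℝ => √(1 + y ^ 2)) (2 * y / (2 * √(1 + y ^ 2))) y := by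
    refine HasDerivAt.sqrt ?_ (by positivity)
    simpa using (hasDerivAt_pow 2 y).const_add 1
  have hlin : HasDerivAt (fun y : ℝ => 1 + x * y) x y := by
    simpa using ((hasDerivAt_id y).const_mul x).const_add 1
  have h := (((hlin.add (hsqrt.const_mul (√(1 + x ^ 2)))).log hpos.ne').sub
    (((hasDerivAt_id y).sub_const x).log hsub)).div_const (√(1 + x ^ 2))
  refine h.congr_deriv ?_
  simp only [Pi.add_apply, id]
  have hneg : 1 / (y - x) = -(1 / (x - y)) := by rw [← neg_sub x y, one_div_neg_eq_neg_one_div]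
  rw [hneg]
  generalize √(1 + y ^ 2) = w at *
  generalize √(1 + x ^ 2) = v at *
  have hpos' := hpos.ne'
  field_simp
  linear_combination v * hw2 - w * hv2

theorem tendsto_log_sub_log_atTop (x : ℝ) :
    Tendsto (fun y => (Real.log (1 + x * y + √(1 + x ^ 2) * √(1 + y ^ 2))
      - Real.log (y - x)) / √(1 + x ^ 2)) atTop
      (nhds (Real.log (√(1 + x ^ 2) + x) / √(1 + x ^ 2))) := by
  have hpos : 0 < √(1 + x ^ 2) + x := by
    linarith [abs_lt_sqrt_one_add_sq x, neg_abs_le x]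
  have hcont : ContinuousAt (fun t : ℝ => Real.log ((t + x + √(1 + x ^ 2) * √(t ^ 2 + 1))
      / (1 - x * t)) / √(1 + x ^ 2)) 0 := by
    refine (ContinuousAt.log (ContinuousAt.div (by fun_prop) (by fun_prop) (by simp)) ?_).div_const _
    simpa using (by linarith : x + √(1 + x ^ 2) ≠ 0)
  have h := hcont.tendsto.comp tendsto_inv_atTop_zero
  have h0 : Real.log ((0 + x + √(1 + x ^ 2) * √((0 : ℝ) ^ 2 + 1)) / (1 - x * 0)) / √(1 + x ^ 2) =
      Real.log (√(1 + x ^ 2) + x) / √(1 + x ^ 2) := by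
    simp [add_comm]
  rw [h0] at h
  refine h.congr' ?_
  filter_upwards [eventually_gt_atTop 0, eventually_gt_atTop x] with y hy hyx
  have hsub : y - x ≠ 0 := (sub_pos.mpr hyx).ne'
  have hs : √((y⁻¹) ^ 2 + 1) = √(1 + y ^ 2) / y := by
    rw [eq_div_iff hy.ne']
    nth_rewrite 2 [← Real.sqrt_sq hy.le]
    rw [← Real.sqrt_mul (by positivity)]
    congr 1
    field_simp
  have hquot : (y⁻¹ + x + √(1 + x ^ 2) * (√(1 + y ^ 2) / y)) / (1 - x * y⁻¹) =
      (1 + x * y + √(1 + x ^ 2) * √(1 + y ^ 2)) / (y - x) := by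
    have h1 : 1 - x * y⁻¹ = (y - x) / y := by field_simp
    rw [h1]
    field_simp
  simp only [Function.comp_apply]
  rw [hs, hquot, Real.log_div (one_add_mul_add_sqrt_pos x y).ne' hsub]

theorem integrableOn_Ioi_one_div_sqrt_mul_sub {x a : ℝ} (ha : x < a) :
    IntegrableOn (fun y => 1 / (√(1 + y ^ 2) * (x - y))) (Set.Ioi a) :=
  integrableOn_Ioi_deriv_of_nonpos'
    (fun _ hy => hasDerivAt_log_sub_log (ha.trans_le hy))
    (fun y hy => one_div_nonpos.mpr (mul_nonpos_of_nonneg_of_nonpos (Real.sqrt_nonneg _)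
      (by linarith [Set.mem_Ioi.mp hy]))) (tendsto_log_sub_log_atTop x)

theorem integral_Ioi_one_div_sqrt_mul_sub {x a : ℝ} (ha : x < a) :
    ∫ y in Set.Ioi a, 1 / (√(1 + y ^ 2) * (x - y)) =
      Real.log (√(1 + x ^ 2) + x) / √(1 + x ^ 2) -
        (Real.log (1 + x * a + √(1 + x ^ 2) * √(1 + a ^ 2)) - Real.log (a - x))
          / √(1 + x ^ 2) :=
  integral_Ioi_of_hasDerivAt_of_tendsto' (fun _ hy => hasDerivAt_log_sub_log (ha.trans_le hy))
    (integrableOn_Ioi_one_div_sqrt_mul_sub ha) (tendsto_log_sub_log_atTop x)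

theorem integrableOn_Ici_one_div_sqrt_mul_sub {x a : ℝ} (ha : x < a) :
    IntegrableOn (fun y => 1 / (√(1 + y ^ 2) * (x - y))) (Set.Ici a) := by
  rw [integrableOn_Ici_iff_integrableOn_Ioi]
  exact integrableOn_Ioi_one_div_sqrt_mul_sub ha

theorem setOf_le_abs_sub (x ε : ℝ) :
    {y : ℝ | ε ≤ |x - y|} = Set.Iic (x - ε) ∪ Set.Ici (x + ε) := by
  ext y
  simp only [Set.mem_ofPred_eq, le_abs, Set.mem_union, Set.mem_Iic, Set.mem_Ici]
  constructor <;> rintro (h | h) <;> [left; right; left; right] <;> linarith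

theorem one_div_sqrt_mul_sub_neg (x y : ℝ) :
    1 / (√(1 + y ^ 2) * (x - y)) = -(1 / (√(1 + (-y) ^ 2) * (-x - -y))) := by
  rw [neg_sq, show -x - -y = -(x - y) by ring, mul_neg, one_div_neg_eq_neg_one_div, neg_neg]

theorem integrableOn_Iic_one_div_sqrt_mul_sub {x a : ℝ} (ha : a < x) :
    IntegrableOn (fun y => 1 / (√(1 + y ^ 2) * (x - y))) (Set.Iic a) := by
  have h := integrableOn_Ici_one_div_sqrt_mul_sub (neg_lt_neg ha)
  have hemb : MeasurableEmbedding (Neg.neg : ℝ → ℝ) :=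
    (Homeomorph.neg ℝ).isClosedEmbedding.measurableEmbedding
  rw [← Measure.map_neg_eq_self (volume : Measure ℝ), hemb.integrableOn_map_iff,
    Set.neg_preimage, Set.neg_Ici, neg_neg] at h
  refine h.neg.congr_fun (fun y _ => ?_) measurableSet_Iic
  exact (one_div_sqrt_mul_sub_neg x y).symm

theorem integral_Iic_one_div_sqrt_mul_sub {x a : ℝ} (ha : a < x) :
    ∫ y in Set.Iic a, 1 / (√(1 + y ^ 2) * (x - y)) =
      (Real.log (1 + x * a + √(1 + x ^ 2) * √(1 + a ^ 2)) - Real.log (x - a)) / √(1 + x ^ 2)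
        - Real.log (√(1 + x ^ 2) - x) / √(1 + x ^ 2) := by
  simp_rw [one_div_sqrt_mul_sub_neg x]
  rw [integral_neg, integral_comp_neg_Iic a fun y => 1 / (√(1 + y ^ 2) * (-x - y)),
    integral_Ioi_one_div_sqrt_mul_sub (neg_lt_neg ha)]
  simp only [neg_sq, neg_mul_neg, ← sub_eq_add_neg, sub_neg_eq_add, neg_add_eq_sub]
  ring

theorem hasPV_one_div_sqrt (x : ℝ) :
    HasPV x (fun y => ((1 / √(1 + y ^ 2) : ℝ) : ℂ))
      (((Real.log (√(1 + x ^ 2) + x) - Real.log (√(1 + x ^ 2) - x)) / √(1 + x ^ 2) : ℝ) : ℂ) := by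
  have hfun : (fun y : ℝ => ((1 / √(1 + y ^ 2) : ℝ) : ℂ) / ((x : ℂ) - y)) =
      fun y : ℝ => ((1 / (√(1 + y ^ 2) * (x - y)) : ℝ) : ℂ) := by
    funext y
    push_cast
    rw [div_div]
  have hint : ∀ ε : ℝ, 0 < ε → IntegrableOn (fun y : ℝ => 1 / (√(1 + y ^ 2) * (x - y)))
      {y : ℝ | ε ≤ |x - y|} := by
    intro ε hε
    rw [setOf_le_abs_sub]
    exact (integrableOn_Iic_one_div_sqrt_mul_sub (by linarith)).union
      (integrableOn_Ici_one_div_sqrt_mul_sub (by linarith))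
  refine ⟨fun ε hε => ?_, ?_⟩
  · rw [hfun]
    exact (hint ε hε).ofReal
  rw [hfun]
  simp_rw [integral_complex_ofReal]
  refine (Complex.continuous_ofReal.tendsto _).comp ?_
  set F : ℝ → ℝ := fun a => Real.log (1 + x * a + √(1 + x ^ 2) * √(1 + a ^ 2)) with hF
  have hFc : Continuous F :=
    Continuous.log (by fun_prop) fun a => (one_add_mul_add_sqrt_pos x a).ne'
  have hlim : Tendsto (fun ε : ℝ => (Real.log (√(1 + x ^ 2) + x) - Real.log (√(1 + x ^ 2) - x)
      + F (x - ε) - F (x + ε)) / √(1 + x ^ 2)) (nhdsWithin 0 (Set.Ioi 0))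
      (nhds ((Real.log (√(1 + x ^ 2) + x) - Real.log (√(1 + x ^ 2) - x)
        + F (x - 0) - F (x + 0)) / √(1 + x ^ 2))) :=
    ((by fun_prop : Continuous fun ε : ℝ => (Real.log (√(1 + x ^ 2) + x)
      - Real.log (√(1 + x ^ 2) - x) + F (x - ε) - F (x + ε)) / √(1 + x ^ 2)).tendsto 0).mono_left
      nhdsWithin_le_nhds
  rw [sub_zero, add_zero, add_sub_cancel_right] at hlim
  refine hlim.congr' ?_
  filter_upwards [self_mem_nhdsWithin] with ε hε
  have hε' : 0 < ε := hε
  have hdisj : Disjoint (Set.Iic (x - ε)) (Set.Ici (x + ε)) :=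
    Set.Iic_disjoint_Ici.mpr (by linarith)
  rw [setOf_le_abs_sub, setIntegral_union hdisj measurableSet_Ici
    (integrableOn_Iic_one_div_sqrt_mul_sub (by linarith))
    (integrableOn_Ici_one_div_sqrt_mul_sub (by linarith)),
    integral_Ici_eq_integral_Ioi, integral_Iic_one_div_sqrt_mul_sub (by linarith),
    integral_Ioi_one_div_sqrt_mul_sub (by linarith), sub_sub_cancel, add_sub_cancel_left]
  simp only [hF]
  ring

theorem hasPV_expArccot_one (x : ℝ) :
    HasPV x (fun y => expArccot y ^ 1 / (1 + (y : ℂ) ^ 2))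
      (1 / (x - Complex.I) * (((Real.log (√(1 + x ^ 2) + x) - Real.log (√(1 + x ^ 2) - x))
        / √(1 + x ^ 2) : ℝ) + 2 * Complex.I)) := by
  have h := ((hasPV_one_div_sqrt x).add (HasPV.of_integrable (x := x)
    (integrable_expArccot_pow_div 1))).const_mul (1 / ((x : ℂ) - Complex.I))
  rw [integral_expArccot_pow_div odd_one, Nat.cast_one, div_one] at h
  convert h using 1
  funext y
  have h1 := ofReal_sub_I_ne_zero x
  have h2 := ofReal_sub_I_ne_zero y
  have h3 := ofReal_add_I_ne_zero y
  have hw : ((√(1 + y ^ 2) : ℝ) : ℂ) ≠ 0 := by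
    exact_mod_cast (by positivity : √(1 + y ^ 2) ≠ 0)
  rw [pow_one, expArccot_eq, ofReal_one_add_sq]
  push_cast
  field_simp
  ring

theorem expArccot_cot {s : ℝ} (hs : s ∈ Set.Ioo 0 Real.pi) :
    expArccot (Real.cot s) = Complex.exp ((s : ℂ) * Complex.I) := by
  have h : Real.arctan (Real.cot s) = Real.pi / 2 - s := by
    rw [Real.cot_eq_cos_div_sin, ← Real.sin_pi_div_two_sub, ← Real.cos_pi_div_two_sub s,
      ← Real.tan_eq_sin_div_cos, Real.arctan_tan (by linarith [hs.2]) (by linarith [hs.1])]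
  rw [expArccot, h, sub_sub_cancel]

theorem sqrt_one_add_cot_sq {s : ℝ} (hs : s ∈ Set.Ioo 0 Real.pi) :
    √(1 + Real.cot s ^ 2) = 1 / Real.sin s := by
  have hsin := Real.sin_pos_of_mem_Ioo hs
  rw [Real.sqrt_eq_iff_mul_self_eq (by positivity) (by positivity), Real.cot_eq_cos_div_sin]
  field_simp
  linarith [Real.sin_sq_add_cos_sq s]

theorem log_sqrt_add_cot_sub_log {s : ℝ} (hs : s ∈ Set.Ioo 0 Real.pi) :
    Real.log (√(1 + Real.cot s ^ 2) + Real.cot s) - Real.log (√(1 + Real.cot s ^ 2) - Real.cot s) =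
      2 * Real.log (Real.cot (s / 2)) := by
  have hsin := (Real.sin_pos_of_mem_Ioo hs).ne'
  have hhalf := (Real.sin_pos_of_pos_of_lt_pi (x := s / 2) (by linarith [hs.1])
    (by linarith [hs.1, hs.2])).ne'
  have hcos := (Real.cos_pos_of_mem_Ioo (x := s / 2)
    ⟨by linarith [hs.1, Real.pi_pos], by linarith [hs.2]⟩).ne'
  have h2 : Real.sin s = 2 * Real.sin (s / 2) * Real.cos (s / 2) := by
    rw [← Real.sin_two_mul]; ring_nf
  have h3 : Real.cos s = 2 * Real.cos (s / 2) ^ 2 - 1 := by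
    rw [← Real.cos_two_mul]; ring_nf
  have hadd : √(1 + Real.cot s ^ 2) + Real.cot s = Real.cot (s / 2) := by
    rw [sqrt_one_add_cot_sq hs, Real.cot_eq_cos_div_sin, Real.cot_eq_cos_div_sin, h2, h3]
    field_simp
    ring
  have hsub : √(1 + Real.cot s ^ 2) - Real.cot s = (Real.cot (s / 2))⁻¹ := by
    rw [sqrt_one_add_cot_sq hs, Real.cot_eq_cos_div_sin, Real.cot_eq_cos_div_sin, h2, h3]
    field_simp
    linear_combination (-2) * Real.sin_sq_add_cos_sq (s / 2)
  rw [hadd, hsub, Real.log_inv]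
  ring

theorem one_div_cot_sub_I {s : ℝ} (hs : s ∈ Set.Ioo 0 Real.pi) :
    1 / ((Real.cot s : ℂ) - Complex.I) = Real.sin s * Complex.exp ((s : ℂ) * Complex.I) := by
  have hsin : (Real.sin s : ℂ) ≠ 0 := by
    exact_mod_cast (Real.sin_pos_of_mem_Ioo hs).ne'
  have h1 := ofReal_sub_I_ne_zero (Real.cot s)
  have h2 : (Real.sin s : ℂ) ^ 2 + (Real.cos s : ℂ) ^ 2 = 1 := by
    exact_mod_cast Real.sin_sq_add_cos_sq s
  rw [div_eq_iff h1, Complex.exp_mul_I, ← Complex.ofReal_cos, ← Complex.ofReal_sin,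
    Real.cot_eq_cos_div_sin, Complex.ofReal_div]
  field_simp
  linear_combination (Real.sin s : ℂ) ^ 2 * Complex.I_sq - h2

theorem hasPV_expArccot_pow {s : ℝ} (hs : s ∈ Set.Ioo 0 Real.pi) (N : ℕ) :
    HasPV (Real.cot s) (fun y => expArccot y ^ (2 * N + 1) / (1 + (y : ℂ) ^ 2))
      (Real.sin s * (Complex.exp ((((2 * N + 1) * s : ℝ) : ℂ) * Complex.I) *
          ((2 * Real.sin s * Real.log (Real.cot (s / 2)) : ℝ) + 2 * Complex.I)
        + ∑ j ∈ Finset.range N, Complex.exp ((((2 * N + 1 - 2 * j - 2) * s : ℝ) : ℂ) * Complex.I) *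
          (((4 / (1 - 4 * ((j : ℝ) + 1) ^ 2) : ℝ) : ℂ) * Complex.I))) := by
  induction N with
  | zero =>
    convert hasPV_expArccot_one (Real.cot s) using 1
    rw [log_sqrt_add_cot_sub_log hs, sqrt_one_add_cot_sq hs, one_div_cot_sub_I hs]
    simp
    ring
  | succ N ih =>
    have h := ih.expArccot_step ⟨N, rfl⟩
    rw [show 2 * (N + 1) + 1 = 2 * N + 1 + 2 by ring]
    convert h using 1
    have hcoef : (1 : ℂ) / ((2 * N + 1 + 2 : ℕ) : ℂ) - 1 / ((2 * N + 1 : ℕ) : ℂ) =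
        (((4 / (1 - 4 * ((N : ℝ) + 1) ^ 2) : ℝ) : ℂ)) / 2 := by
      have h1 : (2 * (N : ℝ) + 1) ≠ 0 := by positivity
      have h2 : (2 * (N : ℝ) + 1 + 2) ≠ 0 := by positivity
      have h3 : (1 - 4 * ((N : ℝ) + 1) ^ 2) ≠ 0 := by
        rw [show 1 - 4 * ((N : ℝ) + 1) ^ 2 = -((2 * N + 1) * (2 * N + 1 + 2)) by ring]
        exact neg_ne_zero.mpr (mul_ne_zero h1 h2)
      have : (1 : ℝ) / ((2 * N + 1 + 2 : ℕ) : ℝ) - 1 / ((2 * N + 1 : ℕ) : ℝ) =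
          (4 / (1 - 4 * ((N : ℝ) + 1) ^ 2)) / 2 := by
        push_cast
        field_simp
        ring
      have hc := congrArg (fun r : ℝ => (r : ℂ)) this
      push_cast at hc ⊢
      exact hc
    have hexp : ∀ t t' : ℝ, t' = t + 2 * s → Complex.exp ((t' : ℂ) * Complex.I) =
        Complex.exp ((s : ℂ) * Complex.I) ^ 2 * Complex.exp ((t : ℂ) * Complex.I) := by
      rintro t t' rfl
      rw [← Complex.exp_nat_mul, ← Complex.exp_add]
      push_cast
      ring_nf
    have hterm : ∀ j : ℕ,
        Complex.exp ((((2 * (N + 1 : ℕ) + 1 - 2 * j - 2) * s : ℝ) : ℂ) * Complex.I) =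
        Complex.exp ((s : ℂ) * Complex.I) ^ 2 *
          Complex.exp ((((2 * N + 1 - 2 * j - 2) * s : ℝ) : ℂ) * Complex.I) :=
      fun j => hexp _ _ (by push_cast; ring)
    have hlast : (2 * ((N + 1 : ℕ) : ℝ) + 1 - 2 * N - 2) * s = s := by push_cast; ring
    rw [Finset.sum_range_succ, hlast, hexp ((2 * N + 1) * s) _ (by push_cast; ring), hcoef,
      expArccot_cot hs, div_eq_mul_one_div _ ((Real.cot s : ℂ) - Complex.I), one_div_cot_sub_I hs]
    simp_rw [hterm, mul_assoc (Complex.exp _ ^ 2)]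
    rw [← Finset.mul_sum]
    ring

theorem sum_cos_eq_sum_sin (k s : ℝ) (N : ℕ) :
    2 * Real.sin s * Real.cos (k * s) + ∑ j ∈ Finset.range N,
        Real.sin s * (Real.cos ((k - 2 * j - 2) * s) * (4 / (1 - 4 * ((j : ℝ) + 1) ^ 2))) =
      2 * Real.sin (k * s) * Real.cos s + 8 * ∑ n ∈ Finset.range (N + 1),
          Real.sin ((k - 1 - 2 * n) * s)
            / ((2 * (n : ℝ) - 1) * (2 * (n : ℝ) + 1) * (2 * (n : ℝ) + 3))
        + 2 / ((2 * N + 1) * (2 * N + 3)) * Real.sin ((k - 1 - 2 * N) * s) := by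
  induction N with
  | zero =>
    have h : Real.sin ((k - 1) * s) =
        Real.sin (k * s) * Real.cos s - Real.cos (k * s) * Real.sin s := by
      rw [← Real.sin_sub]; ring_nf
    simp
    rw [h]
    ring
  | succ N ih =>
    have h1 : Real.sin ((k - 1 - 2 * N) * s) =
        Real.sin ((k - 2 * N - 2) * s) * Real.cos s
          + Real.cos ((k - 2 * N - 2) * s) * Real.sin s := by
      rw [← Real.sin_add]; ring_nf
    have h2 : Real.sin ((k - 1 - 2 * (N + 1 : ℕ)) * s) =
        Real.sin ((k - 2 * N - 2) * s) * Real.cos s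
          - Real.cos ((k - 2 * N - 2) * s) * Real.sin s := by
      rw [← Real.sin_sub]; push_cast; ring_nf
    rw [Finset.sum_range_succ, Finset.sum_range_succ _ (N + 1), ← add_assoc, ih, h1, h2]
    have p1 : (2 * (N : ℝ) + 1) ≠ 0 := by positivity
    have p3 : (2 * (N : ℝ) + 3) ≠ 0 := by positivity
    have p5 : (2 * (N : ℝ) + 5) ≠ 0 := by positivity
    have e : 1 - 4 * ((N : ℝ) + 1) ^ 2 = -((2 * N + 1) * (2 * N + 3)) := by ring
    have e1 : 2 * ((N + 1 : ℕ) : ℝ) - 1 = 2 * N + 1 := by push_cast; ring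
    have e2 : 2 * ((N + 1 : ℕ) : ℝ) + 1 = 2 * N + 3 := by push_cast; ring
    have e3 : 2 * ((N + 1 : ℕ) : ℝ) + 3 = 2 * N + 5 := by push_cast; ring
    rw [e, e1, e2, e3]
    generalize Real.sin ((k - 2 * N - 2) * s) = A
    generalize Real.cos ((k - 2 * N - 2) * s) = B
    field_simp
    ring

theorem im_hasPV_expArccot_pow (s : ℝ) (N : ℕ) :
    (Real.sin s * (Complex.exp ((((2 * N + 1) * s : ℝ) : ℂ) * Complex.I) *
          ((2 * Real.sin s * Real.log (Real.cot (s / 2)) : ℝ) + 2 * Complex.I)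
        + ∑ j ∈ Finset.range N, Complex.exp ((((2 * N + 1 - 2 * j - 2) * s : ℝ) : ℂ) * Complex.I) *
          (((4 / (1 - 4 * ((j : ℝ) + 1) ^ 2) : ℝ) : ℂ) * Complex.I))).im =
      2 * Real.sin ((2 * N + 1) * s)
          * (Real.cos s + Real.sin s ^ 2 * Real.log (Real.cot (s / 2)))
        + 8 * ∑ n ∈ Finset.range (N + 1), Real.sin ((2 * N + 1 - 1 - 2 * n) * s)
            / ((2 * (n : ℝ) - 1) * (2 * (n : ℝ) + 1) * (2 * (n : ℝ) + 3)) := by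
  have hterm : ∀ t r : ℝ, (Complex.exp ((t : ℂ) * Complex.I) * ((r : ℂ) * Complex.I)).im =
      Real.cos t * r := by
    intro t r
    rw [Complex.mul_im, Complex.exp_ofReal_mul_I_re]
    simp
  have h := sum_cos_eq_sum_sin (2 * N + 1) s N
  rw [show (2 * (N : ℝ) + 1 - 1 - 2 * N) * s = 0 by ring, Real.sin_zero, mul_zero, add_zero] at h
  have hfirst : ∀ t r : ℝ, (Complex.exp ((t : ℂ) * Complex.I) * ((r : ℂ) + 2 * Complex.I)).im =
      Real.cos t * 2 + Real.sin t * r := by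
    intro t r
    rw [Complex.mul_im, Complex.exp_ofReal_mul_I_re, Complex.exp_ofReal_mul_I_im]
    simp
  rw [Complex.im_ofReal_mul, Complex.add_im, Complex.im_sum, hfirst]
  simp_rw [hterm]
  rw [mul_add, Finset.mul_sum]
  linear_combination h

theorem deriv_cos_mul_arccot (k : ℕ) (y : ℝ) :
    deriv (fun y : ℝ => Real.cos (k * (Real.pi / 2 - Real.arctan y))) y =
      k * (expArccot y ^ k / (1 + (y : ℂ) ^ 2)).im := by
  have h := (((Real.hasDerivAt_arctan y).const_sub (Real.pi / 2)).const_mul (k : ℝ)).cos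
  rw [h.deriv, show (1 : ℂ) + (y : ℂ) ^ 2 = ((1 + y ^ 2 : ℝ) : ℂ) by push_cast; ring,
    Complex.div_ofReal_im, expArccot_pow, Complex.exp_ofReal_mul_I_im]
  ring

/-- For `k` an odd positive integer, `s ∈ (0, π)`, `x = cot s` and
`u(y) = cos(k·(π/2 − arctan y))`, the principal value `(1/π)·PV∫ u'(y)/(x−y) dy` exists and
equals `(2k/π)sin(ks)(cos s + sin² s·ln(cot(s/2)))
 + (8k/π)∑_{n=0}^{(k−1)/2} sin((k−1−2n)s)/((2n−1)(2n+1)(2n+3))`. -/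
theorem halfLaplacian_cos_odd (k : ℕ) (hk : Odd k) (hkpos : 0 < k)
    (s : ℝ) (hs : s ∈ Set.Ioo 0 Real.pi) (x : ℝ) (hx : x = Real.cot s) :
    Tendsto (fun ε : ℝ => (1 / Real.pi) *
        ∫ y in {y : ℝ | ε ≤ |x - y|},
          deriv (fun y : ℝ => Real.cos (k * (Real.pi / 2 - Real.arctan y))) y / (x - y))
      (nhdsWithin 0 (Set.Ioi 0))
      (nhds (
        (2 * k / Real.pi) * Real.sin (k * s)
            * (Real.cos s + (Real.sin s) ^ 2 * Real.log (Real.cot (s / 2)))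
        + (8 * k / Real.pi) * ∑ n ∈ Finset.range ((k - 1) / 2 + 1),
            Real.sin (((k : ℝ) - 1 - 2 * n) * s)
              / ((2 * (n : ℝ) - 1) * (2 * (n : ℝ) + 1) * (2 * (n : ℝ) + 3)))) := by
  obtain ⟨N, rfl⟩ := hk
  subst hx
  have hPV := hasPV_expArccot_pow hs N
  have him := (Complex.continuous_im.tendsto _).comp hPV.2
  rw [im_hasPV_expArccot_pow] at him
  have hlim := him.const_mul ((1 / Real.pi) * ((2 * N + 1 : ℕ) : ℝ))
  have hdiv : (2 * N + 1 - 1) / 2 = N := by omega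
  convert hlim.congr' ?_ using 2
  · rw [hdiv]
    push_cast
    ring
  · filter_upwards [self_mem_nhdsWithin] with ε hε
    simp only [Function.comp_apply]
    rw [mul_assoc]
    congr 1
    rw [← Complex.imCLM_apply, ← Complex.imCLM.integral_comp_comm (hPV.1 ε hε),
      ← integral_const_mul]
    congr 1
    funext y
    rw [deriv_cos_mul_arccot, Complex.imCLM_apply, ← Complex.ofReal_sub, Complex.div_ofReal_im,
      mul_div_assoc]
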